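/- (Tightness of the SDP relaxation.) For all integers 1 ≤ K ≤ D, every number of output channels C ≥ 1, and every w ∈ ℝ^D, the induced regularizer equals the value of the semidefinite program: R_{K,C}(w) = R_SDP^K(w). -/

import Mathlib

open scoped BigOperators

/-- Circular convolution of `u ∈ ℝ^K` with `v ∈ ℝ^D`:
`(u⋆v)[d] = (1/√D)·Σ_{k=0}^{K-1} u[k]·v[(d+k) mod D]`. -/
noncomputable def circConv {K D : ℕ} (u : Fin K → ℝ) (v : Fin D → ℝ) : Fin D → ℝ :=
  fun d => (1 / Real.sqrt D) * ∑ k : Fin K, u k * v ⟨((d : ℕ) + (k : ℕ)) % D, Nat.mod_lt _ d.pos⟩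

/-- Flip of a vector: `z↓[d] = z[D-1-d]`. -/
def flipVec {D : ℕ} (z : Fin D → ℝ) : Fin D → ℝ :=
  fun d => z ⟨D - 1 - (d : ℕ), by have := d.isLt; omega⟩

/-- Linear predictor realized by a two-layer linear convolutional network with
kernel size `K` and `C` output channels: `w(U,V) = Σ_c (U[:,c] ⋆ (V[:,c])↓)↓`. -/
noncomputable def predictor {K D C : ℕ} (U : Fin K → Fin C → ℝ) (V : Fin D → Fin C → ℝ) :
    Fin D → ℝ :=
  fun d => ∑ c : Fin C, flipVec (circConv (fun k => U k c) (flipVec (fun l => V l c))) d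

/-- The induced regularizer
`R_{K,C}(w) = inf { ‖U‖_F² + ‖V‖_F² : w(U,V) = w }`. -/
noncomputable def inducedReg (K D C : ℕ) (w : Fin D → ℝ) : ℝ :=
  sInf { t : ℝ | ∃ (U : Fin K → Fin C → ℝ) (V : Fin D → Fin C → ℝ),
    predictor U V = w ∧ t = (∑ k, ∑ c, (U k c) ^ 2) + ∑ l, ∑ c, (V l c) ^ 2 }

/-- Discrete Fourier transform: `ŵ[d] = (1/√D)·Σ_l w[l]·exp(-2πi·d·l/D)`. -/
noncomputable def dft {D : ℕ} (w : Fin D → ℝ) : Fin D → ℂ :=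
  fun d => (1 / (Real.sqrt D : ℂ)) * ∑ l : Fin D, (w l : ℂ) *
    Complex.exp (-((2 : ℂ) * (Real.pi : ℂ) * Complex.I * ((d : ℕ) : ℂ) * ((l : ℕ) : ℂ)) / (D : ℂ))

/-- The SDP relaxation value `R_SDP^K(w)`: the infimum of `trace(Z)` over real symmetric
positive semidefinite matrices `Z ∈ ℝ^{(K+D)×(K+D)}` satisfying, for each `d ∈ [D]`,
`Σ_{k,l} (1/D)·exp(-2πi·d·(k+l)/D)·Z[k, K+l] = ŵ[d]`. -/
noncomputable def sdpValue (K D : ℕ) (w : Fin D → ℝ) : ℝ :=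
  sInf { t : ℝ | ∃ Z : Matrix (Fin (K + D)) (Fin (K + D)) ℝ, Z.PosSemidef ∧
    (∀ d : Fin D, ∑ k : Fin K, ∑ l : Fin D,
      (1 / (D : ℂ)) *
        Complex.exp (-((2 : ℂ) * (Real.pi : ℂ) * Complex.I * ((d : ℕ) : ℂ) *
          (((k : ℕ) : ℂ) + ((l : ℕ) : ℂ))) / (D : ℂ)) *
        ((Z (Fin.castAdd D k) (Fin.natAdd K l) : ℝ) : ℂ) = dft w d) ∧
    t = ∑ i, Z i i }

open scoped ComplexConjugate

/-- Evaluation at `z` of the polynomial with real coefficients `a`. -/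
noncomputable def polyEval {K : ℕ} (a : Fin K → ℝ) (z : ℂ) : ℂ :=
  ∑ k, (a k : ℂ) * z ^ (k : ℕ)

theorem continuous_polyEval {K : ℕ} (z : ℂ) :
    Continuous fun a : Fin K → ℝ => polyEval a z := by
  unfold polyEval
  fun_prop

theorem polyEval_lin {K : ℕ} (a b : Fin K → ℝ) (c s : ℝ) (z : ℂ) :
    polyEval (fun k => c * a k + s * b k) z = c * polyEval a z + s * polyEval b z := by
  simp only [polyEval, Finset.mul_sum, ← Finset.sum_add_distrib]
  refine Finset.sum_congr rfl fun k _ => ?_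
  push_cast
  ring

/-- Shifting out a vanishing constant coefficient divides the polynomial by `z`. -/
theorem polyEval_shift {n : ℕ} (b : Fin (n + 1) → ℝ) (hb : b 0 = 0) (z : ℂ) :
    polyEval b z = z * polyEval (Fin.snoc (α := fun _ => ℝ) (fun i => b i.succ) 0) z := by
  simp only [polyEval]
  rw [Fin.sum_univ_succ, Fin.sum_univ_castSucc]
  simp only [hb, Fin.snoc_castSucc, Fin.snoc_last, Fin.val_succ,
    Fin.val_castSucc]
  simp only [Complex.ofReal_zero, zero_mul, zero_add, add_zero, Finset.mul_sum]
  refine Finset.sum_congr rfl fun k _ => ?_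
  ring

theorem sum_sq_shift {n : ℕ} (b : Fin (n + 1) → ℝ) (hb : b 0 = 0) :
    ∑ k, (Fin.snoc (α := fun _ => ℝ) (fun i => b i.succ) 0 : Fin (n + 1) → ℝ) k ^ 2
      = ∑ k, b k ^ 2 := by
  rw [Fin.sum_univ_succ (fun k => b k ^ 2), Fin.sum_univ_castSucc]
  simp [hb]

theorem exists_rotation (x y : ℝ) : ∃ c s : ℝ, c ^ 2 + s ^ 2 = 1 ∧ -s * x + c * y = 0 := by
  by_cases h : x ^ 2 + y ^ 2 = 0
  · have hx : x = 0 := by nlinarith [sq_nonneg x, sq_nonneg y]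
    have hy : y = 0 := by nlinarith [sq_nonneg x, sq_nonneg y]
    exact ⟨1, 0, by norm_num, by simp [hy]⟩
  · have hr : Real.sqrt (x ^ 2 + y ^ 2) ^ 2 = x ^ 2 + y ^ 2 := Real.sq_sqrt (by positivity)
    have hr0 : Real.sqrt (x ^ 2 + y ^ 2) ≠ 0 := fun h0 => h (by rw [← hr, h0]; norm_num)
    refine ⟨x / Real.sqrt (x ^ 2 + y ^ 2), y / Real.sqrt (x ^ 2 + y ^ 2), ?_, ?_⟩
    · rw [div_pow, div_pow, hr, ← add_div, div_self h]
    · ring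

theorem norm_sq_rotation {c s : ℝ} (h : c ^ 2 + s ^ 2 = 1) (x y : ℂ) :
    ‖(c : ℂ) * x + s * y‖ ^ 2 + ‖((-s : ℝ) : ℂ) * x + c * y‖ ^ 2 = ‖x‖ ^ 2 + ‖y‖ ^ 2 := by
  simp only [← Complex.normSq_eq_norm_sq, Complex.normSq_apply, Complex.add_re, Complex.add_im,
    Complex.mul_re, Complex.mul_im, Complex.ofReal_re, Complex.ofReal_im]
  linear_combination (x.re ^ 2 + x.im ^ 2 + y.re ^ 2 + y.im ^ 2) * h

/-- Spectral factorization: a sum of two squared moduli of real polynomials is, on the unit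
circle, the squared modulus of a single real polynomial of no larger degree. -/
theorem exists_spectral_factor_two {K : ℕ} (a b : Fin K → ℝ) :
    ∃ u : Fin K → ℝ, (∀ z : ℂ, ‖z‖ = 1 →
        ‖polyEval u z‖ ^ 2 = ‖polyEval a z‖ ^ 2 + ‖polyEval b z‖ ^ 2) ∧
      ∑ k, u k ^ 2 = ∑ k, a k ^ 2 + ∑ k, b k ^ 2 := by
  obtain _ | n := K
  · exact ⟨a, by simp [polyEval], by simp⟩
  set S : Set ((Fin (n + 1) → ℝ) × (Fin (n + 1) → ℝ)) :=
    {p | (∀ z : ℂ, ‖z‖ = 1 → ‖polyEval p.1 z‖ ^ 2 + ‖polyEval p.2 z‖ ^ 2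
        = ‖polyEval a z‖ ^ 2 + ‖polyEval b z‖ ^ 2) ∧
      ∑ k, p.1 k ^ 2 + ∑ k, p.2 k ^ 2 = ∑ k, a k ^ 2 + ∑ k, b k ^ 2} with hS
  have hclosed : IsClosed S := by
    rw [hS, Set.ofPred_and, Set.ofPred_forall]
    refine IsClosed.inter (isClosed_iInter fun z => ?_) ?_
    · rw [Set.ofPred_forall]
      refine isClosed_iInter fun _ => ?_
      have h1 := (continuous_polyEval (K := n + 1) z).comp
        (continuous_fst (Y := Fin (n + 1) → ℝ))
      have h2 := (continuous_polyEval (K := n + 1) z).comp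
        (continuous_snd (X := Fin (n + 1) → ℝ))
      exact isClosed_eq ((h1.norm.pow 2).add (h2.norm.pow 2)) continuous_const
    · exact isClosed_eq (by fun_prop) continuous_const
  have hbdd : Bornology.IsBounded S := by
    set N := ∑ k, a k ^ 2 + ∑ k, b k ^ 2 with hN
    have hN0 : 0 ≤ N := by positivity
    refine (Metric.isBounded_closedBall (x := 0) (r := N + 1)).subset fun p hp => ?_
    have hp2 : ∑ k, p.1 k ^ 2 + ∑ k, p.2 k ^ 2 = N := hp.2
    have h1 : ∀ k, p.1 k ^ 2 ≤ N := fun k => by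
      have := Finset.single_le_sum (f := fun k => p.1 k ^ 2) (fun i _ => sq_nonneg _)
        (Finset.mem_univ k)
      have h' : 0 ≤ ∑ k, p.2 k ^ 2 := by positivity
      linarith
    have h2 : ∀ k, p.2 k ^ 2 ≤ N := fun k => by
      have := Finset.single_le_sum (f := fun k => p.2 k ^ 2) (fun i _ => sq_nonneg _)
        (Finset.mem_univ k)
      have h' : 0 ≤ ∑ k, p.1 k ^ 2 := by positivity
      linarith
    rw [mem_closedBall_zero_iff, Prod.norm_def, max_le_iff,
      pi_norm_le_iff_of_nonneg (by linarith), pi_norm_le_iff_of_nonneg (by linarith)]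
    refine ⟨fun k => ?_, fun k => ?_⟩
    · exact abs_le_of_sq_le_sq (by nlinarith [h1 k]) (by linarith)
    · exact abs_le_of_sq_le_sq (by nlinarith [h2 k]) (by linarith)
  obtain ⟨p, hpS, hmax⟩ := (Metric.isCompact_of_isClosed_isBounded hclosed hbdd).exists_isMaxOn
    (⟨(a, b), fun _ _ => rfl, rfl⟩ : S.Nonempty)
    (f := fun p => p.1 0 ^ 2 + p.2 0 ^ 2) (by fun_prop)
  obtain ⟨c, s, hcs, h0⟩ := exists_rotation (p.1 0) (p.2 0)
  set a' : Fin (n + 1) → ℝ := fun k => c * p.1 k + s * p.2 k with ha'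
  set b' : Fin (n + 1) → ℝ := fun k => -s * p.1 k + c * p.2 k with hb'
  have hab : (a', b') ∈ S := by
    refine ⟨fun z hz => ?_, ?_⟩
    · rw [← hpS.1 z hz]
      simp only [ha', hb', polyEval_lin]
      exact norm_sq_rotation hcs _ _
    · rw [← hpS.2]
      simp only [ha', hb', ← Finset.sum_add_distrib]
      refine Finset.sum_congr rfl fun k _ => ?_
      linear_combination (p.1 k ^ 2 + p.2 k ^ 2) * hcs
  have hfirst : ∀ y, (a', y) ∈ S → y 0 = 0 := fun y hy => by
    have h1 : a' 0 ^ 2 + y 0 ^ 2 ≤ p.1 0 ^ 2 + p.2 0 ^ 2 := hmax hy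
    have h2 : a' 0 ^ 2 + b' 0 ^ 2 = p.1 0 ^ 2 + p.2 0 ^ 2 := by
      simp only [ha', hb']
      linear_combination (p.1 0 ^ 2 + p.2 0 ^ 2) * hcs
    have h3 : b' 0 = 0 := h0
    rw [h3] at h2
    nlinarith [sq_nonneg (y 0)]
  have hall : ∀ (j : ℕ) (hj : j < n + 1), ∀ y, (a', y) ∈ S → y ⟨j, hj⟩ = 0 := by
    intro j
    induction j with
    | zero => exact fun _ y hy => hfirst y hy
    | succ j ih =>
      intro hj y hy
      have hy0 := hfirst y hy
      have := ih (by omega) (Fin.snoc (α := fun _ => ℝ) (fun i => y i.succ) 0) (by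
        refine ⟨fun z hz => ?_, ?_⟩
        · rw [← hy.1 z hz]
          simp only
          rw [polyEval_shift y hy0 z, norm_mul, hz, one_mul]
        · rw [← hy.2]
          simp only
          rw [sum_sq_shift y hy0])
      have hc : (⟨j, by omega⟩ : Fin (n + 1)) = Fin.castSucc ⟨j, by omega⟩ := rfl
      rw [hc, Fin.snoc_castSucc] at this
      exact this
  have hb0 : b' = fun _ => 0 := funext fun k => hall k k.isLt b' hab
  refine ⟨a', fun z hz => ?_, ?_⟩
  · have := hab.1 z hz
    simpa [hb0, polyEval] using this
  · have := hab.2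
    simpa [hb0] using this

theorem exists_spectral_factor {ι : Type*} {K : ℕ} (t : Finset ι) (a : ι → Fin K → ℝ) :
    ∃ u : Fin K → ℝ, (∀ z : ℂ, ‖z‖ = 1 →
        ‖polyEval u z‖ ^ 2 = ∑ c ∈ t, ‖polyEval (a c) z‖ ^ 2) ∧
      ∑ k, u k ^ 2 = ∑ c ∈ t, ∑ k, a c k ^ 2 := by
  classical
  induction t using Finset.induction_on with
  | empty => exact ⟨0, by simp [polyEval], by simp⟩
  | insert i t hi ih =>
    obtain ⟨v, hv, hv'⟩ := ih
    obtain ⟨u, hu, hu'⟩ := exists_spectral_factor_two (a i) v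
    refine ⟨u, fun z hz => ?_, ?_⟩
    · rw [hu z hz, hv z hz, Finset.sum_insert hi]
    · rw [hu', hv', Finset.sum_insert hi]

/-- The matrix `ω ^ (d * l)` of the unnormalized discrete Fourier transform. -/
def fourierMatrix (D : ℕ) (ω : ℂ) : Matrix (Fin D) (Fin D) ℂ :=
  fun d l => ω ^ ((d : ℕ) * (l : ℕ))

open Matrix in
theorem fourierMatrix_conjTranspose_mul {D : ℕ} {ω : ℂ} (hω : IsPrimitiveRoot ω D) :
    (fourierMatrix D ω)ᴴ * fourierMatrix D ω = (D : ℂ) • (1 : Matrix (Fin D) (Fin D) ℂ) := by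
  ext l m
  have hD : D ≠ 0 := l.pos.ne'
  have hn : ‖ω‖ = 1 := hω.norm'_eq_one hD
  have hω0 : ω ≠ 0 := hω.ne_zero hD
  have hconj : conj ω = ω⁻¹ := (Complex.inv_eq_conj hn).symm
  have hterm : ∀ d : Fin D, (fourierMatrix D ω)ᴴ l d * fourierMatrix D ω d m
      = (ω⁻¹ ^ (l : ℕ) * ω ^ (m : ℕ)) ^ (d : ℕ) := fun d => by
    simp only [fourierMatrix, conjTranspose_apply, RCLike.star_def, map_pow, hconj, mul_pow,
      ← pow_mul]
    rw [mul_comm (d : ℕ), mul_comm (d : ℕ)]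
  rw [mul_apply, Finset.sum_congr rfl fun d _ => hterm d]
  rw [Matrix.smul_apply, one_apply, Fin.sum_univ_eq_sum_range
    (fun d => (ω⁻¹ ^ (l : ℕ) * ω ^ (m : ℕ)) ^ d)]
  split_ifs with h
  · subst h
    rw [← mul_pow, inv_mul_cancel₀ hω0]
    simp
  · have hne : ω⁻¹ ^ (l : ℕ) * ω ^ (m : ℕ) ≠ 1 := fun h1 => by
      rw [inv_pow, inv_mul_eq_one₀ (pow_ne_zero _ hω0)] at h1
      exact h (Fin.ext (hω.pow_inj l.isLt m.isLt h1))
    have hpow : (ω⁻¹ ^ (l : ℕ) * ω ^ (m : ℕ)) ^ D = 1 := by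
      rw [mul_pow, ← pow_mul, ← pow_mul, mul_comm, mul_comm (l : ℕ), mul_comm (m : ℕ), pow_mul,
        pow_mul, inv_pow, hω.pow_eq_one]
      simp
    rw [geom_sum_eq hne, hpow]
    simp

open Matrix in
theorem fourierMatrix_parseval {D : ℕ} {ω : ℂ} (hω : IsPrimitiveRoot ω D) (x : Fin D → ℂ) :
    ∑ d, ‖(fourierMatrix D ω *ᵥ x) d‖ ^ 2 = D * ∑ l, ‖x l‖ ^ 2 := by
  have hdot : ∀ y : Fin D → ℂ, star y ⬝ᵥ y = ((∑ l, ‖y l‖ ^ 2 : ℝ) : ℂ) := fun y => by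
    simp only [dotProduct, Pi.star_apply, RCLike.star_def, Complex.conj_mul']
    push_cast
    rfl
  have h : star (fourierMatrix D ω *ᵥ x) ⬝ᵥ (fourierMatrix D ω *ᵥ x) = D * (star x ⬝ᵥ x) := by
    rw [star_mulVec, ← dotProduct_mulVec, mulVec_mulVec, fourierMatrix_conjTranspose_mul hω,
      smul_mulVec, one_mulVec, dotProduct_smul, smul_eq_mul]
  rw [hdot, hdot] at h
  exact_mod_cast h

open Matrix in
theorem fourierMatrix_bijective {D : ℕ} (hD : D ≠ 0) {ω : ℂ} (hω : IsPrimitiveRoot ω D) :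
    Function.Bijective fun x => fourierMatrix D ω *ᵥ x := by
  have hD' : (D : ℂ) ≠ 0 := Nat.cast_ne_zero.2 hD
  have hl : ((D : ℂ)⁻¹ • (fourierMatrix D ω)ᴴ) * fourierMatrix D ω = 1 := by
    rw [smul_mul, fourierMatrix_conjTranspose_mul hω, smul_smul, inv_mul_cancel₀ hD', one_smul]
  have hr := mul_eq_one_comm.1 hl
  refine ⟨fun x y hxy => ?_, fun f => ⟨((D : ℂ)⁻¹ • (fourierMatrix D ω)ᴴ) *ᵥ f, ?_⟩⟩
  · have := congrArg (fun v => ((D : ℂ)⁻¹ • (fourierMatrix D ω)ᴴ) *ᵥ v) hxy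
    simpa only [mulVec_mulVec, hl, one_mulVec] using this
  · simp only [mulVec_mulVec, hr, one_mulVec]

/-- The index `(d - k) mod D`, in the form produced by the flips in `predictor`. -/
def subIdx {D : ℕ} (d : Fin D) (k : ℕ) : Fin D :=
  ⟨D - 1 - (D - 1 - (d : ℕ) + k) % D, by have := d.isLt; omega⟩

theorem subIdx_add {D : ℕ} (d : Fin D) (k : ℕ) : ∃ q, (subIdx d k : ℕ) + k = D * q + d := by
  have hd := d.isLt
  have h1 := Nat.div_add_mod (D - 1 - (d : ℕ) + k) D
  have h2 := Nat.mod_lt (D - 1 - (d : ℕ) + k) d.pos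
  refine ⟨(D - 1 - (d : ℕ) + k) / D, ?_⟩
  simp only [subIdx]
  omega

theorem subIdx_bijective {D : ℕ} (k : ℕ) : Function.Bijective fun d : Fin D => subIdx d k := by
  refine Finite.injective_iff_bijective.1 fun d e h => Fin.ext ?_
  obtain ⟨q, hq⟩ := subIdx_add d k
  obtain ⟨r, hr⟩ := subIdx_add e k
  have h' : subIdx d k = subIdx e k := h
  have h2 : (D * q + d) % D = (D * r + e) % D := by rw [← hq, ← hr, h']
  rwa [Nat.mul_add_mod, Nat.mul_add_mod, Nat.mod_eq_of_lt d.isLt, Nat.mod_eq_of_lt e.isLt] at h2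

theorem predictor_apply {K D C : ℕ} (U : Fin K → Fin C → ℝ) (V : Fin D → Fin C → ℝ) (d : Fin D) :
    predictor U V d = ∑ c, (1 / Real.sqrt D) * ∑ k, U k c * V (subIdx d k) c := rfl

/-- The Fourier transform turns circular convolution into multiplication. -/
theorem fourierMatrix_mulVec_conv {K D : ℕ} {ω : ℂ} (hω : ω ^ D = 1) (u : Fin K → ℝ)
    (x : Fin D → ℂ) (d : Fin D) :
    (fourierMatrix D ω).mulVec (fun m => ∑ k, (u k : ℂ) * x (subIdx m k)) d
      = polyEval u (ω ^ (d : ℕ)) * (fourierMatrix D ω).mulVec x d := by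
  simp only [Matrix.mulVec, dotProduct, fourierMatrix, polyEval, Finset.mul_sum, Finset.sum_mul]
  rw [Finset.sum_comm]
  rw [Finset.sum_comm (s := Finset.univ (α := Fin D)) (t := Finset.univ (α := Fin K))]
  refine Finset.sum_congr rfl fun k _ => ?_
  rw [← (subIdx_bijective (D := D) k).sum_comp fun m : Fin D =>
    (u k : ℂ) * (ω ^ (d : ℕ)) ^ (k : ℕ) * (ω ^ ((d : ℕ) * (m : ℕ)) * x m)]
  refine Finset.sum_congr rfl fun m _ => ?_
  obtain ⟨q, hq⟩ := subIdx_add m k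
  have h : ω ^ ((d : ℕ) * (m : ℕ)) = (ω ^ (d : ℕ)) ^ (k : ℕ) * ω ^ ((d : ℕ) * (subIdx m k : ℕ)) := by
    rw [← pow_mul, ← pow_add, ← mul_add, add_comm, hq, mul_add, pow_add,
      mul_left_comm, pow_mul ω D, hω, one_pow, one_mul]
  rw [h]
  ring

/-- The primitive root of unity `exp (-2πi/D)` underlying `dft`. -/
noncomputable def dftRoot (D : ℕ) : ℂ :=
  (Complex.exp (2 * Real.pi * Complex.I / D))⁻¹

theorem dftRoot_isPrimitiveRoot {D : ℕ} (hD : D ≠ 0) : IsPrimitiveRoot (dftRoot D) D :=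
  (Complex.isPrimitiveRoot_exp D hD).inv

theorem dftRoot_pow (D n : ℕ) :
    dftRoot D ^ n = Complex.exp (-((2 : ℂ) * Real.pi * Complex.I * n) / D) := by
  rw [dftRoot, ← Complex.exp_neg, ← Complex.exp_nat_mul]
  congr 1
  ring

theorem dft_eq_mulVec {D : ℕ} (w : Fin D → ℝ) (d : Fin D) :
    dft w d = (1 / (Real.sqrt D : ℂ))
      * (fourierMatrix D (dftRoot D)).mulVec (fun l => (w l : ℂ)) d := by
  simp only [dft, Matrix.mulVec, dotProduct, fourierMatrix, dftRoot_pow]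
  congr 1
  refine Finset.sum_congr rfl fun l _ => ?_
  rw [mul_comm]
  push_cast
  ring_nf

/-- The left-hand side of the SDP constraint, for a factored matrix `Z`. -/
theorem sdp_constraint_eq {ι : Type*} [Fintype ι] {K D : ℕ} (U : Fin K → ι → ℝ)
    (V : Fin D → ι → ℝ) (d : Fin D) :
    ∑ k : Fin K, ∑ l : Fin D, (1 / (D : ℂ)) *
        Complex.exp (-((2 : ℂ) * (Real.pi : ℂ) * Complex.I * ((d : ℕ) : ℂ) *
          (((k : ℕ) : ℂ) + ((l : ℕ) : ℂ))) / (D : ℂ)) * ((∑ c, U k c * V l c : ℝ) : ℂ)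
      = (1 / (D : ℂ)) * ∑ c, polyEval (fun k => U k c) (dftRoot D ^ (d : ℕ))
        * (fourierMatrix D (dftRoot D)).mulVec (fun l => (V l c : ℂ)) d := by
  have hexp : ∀ (k : Fin K) (l : Fin D),
      Complex.exp (-((2 : ℂ) * (Real.pi : ℂ) * Complex.I * ((d : ℕ) : ℂ) *
          (((k : ℕ) : ℂ) + ((l : ℕ) : ℂ))) / (D : ℂ))
        = (dftRoot D ^ (d : ℕ)) ^ (k : ℕ) * dftRoot D ^ ((d : ℕ) * (l : ℕ)) := fun k l => by
    rw [← pow_mul, ← pow_add, ← mul_add, dftRoot_pow]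
    push_cast
    ring_nf
  simp only [hexp, polyEval, Matrix.mulVec, dotProduct, fourierMatrix, Finset.mul_sum,
    Finset.sum_mul, Complex.ofReal_sum, Complex.ofReal_mul]
  rw [Finset.sum_comm]
  simp_rw [Finset.sum_comm (s := Finset.univ (α := Fin K)) (t := Finset.univ (α := ι))]
  rw [Finset.sum_comm]
  refine Finset.sum_congr rfl fun c _ => ?_
  refine Finset.sum_congr rfl fun l _ => ?_
  refine Finset.sum_congr rfl fun k _ => ?_
  ring

theorem dft_predictor {K D C : ℕ} (hD : D ≠ 0) (U : Fin K → Fin C → ℝ) (V : Fin D → Fin C → ℝ)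
    (d : Fin D) :
    dft (predictor U V) d = (1 / (D : ℂ)) * ∑ c,
      polyEval (fun k => U k c) (dftRoot D ^ (d : ℕ))
        * (fourierMatrix D (dftRoot D)).mulVec (fun l => (V l c : ℂ)) d := by
  have hs : (Real.sqrt D : ℂ) * (Real.sqrt D : ℂ) = D := by
    rw [← Complex.ofReal_mul, Real.mul_self_sqrt (Nat.cast_nonneg D)]
    simp
  have hp : (fun l => (predictor U V l : ℂ)) = (1 / (Real.sqrt D : ℂ)) • ∑ c,
      (fun m => ∑ k, (U k c : ℂ) * (V (subIdx m k) c : ℂ)) := by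
    funext l
    simp only [predictor_apply, Pi.smul_apply, Finset.sum_apply, smul_eq_mul, Finset.mul_sum]
    push_cast
    rfl
  rw [dft_eq_mulVec, hp, Matrix.mulVec_smul, Matrix.mulVec_sum, Pi.smul_apply, Finset.sum_apply,
    smul_eq_mul, ← mul_assoc]
  congr 1
  · rw [← hs, one_div_mul_one_div]
  · exact Finset.sum_congr rfl fun c _ => fourierMatrix_mulVec_conv
      (dftRoot_isPrimitiveRoot hD).pow_eq_one (fun k => U k c) (fun l => (V l c : ℂ)) d

/-- Any factorization satisfying the SDP constraint can be replaced by a single channel of no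
larger cost. -/
theorem exists_single_channel {ι : Type*} [Fintype ι] {K D : ℕ} (hD : D ≠ 0)
    (U : Fin K → ι → ℝ) (V : Fin D → ι → ℝ) (w : Fin D → ℝ)
    (h : ∀ d : Fin D, (1 / (D : ℂ)) * ∑ c, polyEval (fun k => U k c) (dftRoot D ^ (d : ℕ))
        * (fourierMatrix D (dftRoot D)).mulVec (fun l => (V l c : ℂ)) d = dft w d) :
    ∃ (u : Fin K → ℝ) (v : Fin D → ℝ),
      (∀ d, (1 / Real.sqrt D) * ∑ k, u k * v (subIdx d k) = w d) ∧
      ∑ k, u k ^ 2 + ∑ l, v l ^ 2 ≤ ∑ k, ∑ c, U k c ^ 2 + ∑ l, ∑ c, V l c ^ 2 := by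
  have hω := dftRoot_isPrimitiveRoot hD
  set ω := dftRoot D with hωdef
  have hDpos : (0 : ℝ) < D := by positivity
  have hs : (Real.sqrt D : ℂ) * (Real.sqrt D : ℂ) = D := by
    rw [← Complex.ofReal_mul, Real.mul_self_sqrt (Nat.cast_nonneg D)]
    simp
  have hs0 : (Real.sqrt D : ℂ) ≠ 0 := Complex.ofReal_ne_zero.2 (Real.sqrt_ne_zero'.2 hDpos)
  obtain ⟨u, hu, hu2⟩ := exists_spectral_factor Finset.univ fun c k => U k c
  set P : Fin D → ι → ℂ := fun d c => polyEval (fun k => U k c) (ω ^ (d : ℕ)) with hP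
  set Q : Fin D → ι → ℂ := fun d c => (fourierMatrix D ω).mulVec (fun l => (V l c : ℂ)) d with hQ
  have hun : ∀ d : Fin D, ‖polyEval u (ω ^ (d : ℕ))‖ ^ 2 = ∑ c, ‖P d c‖ ^ 2 := fun d =>
    hu _ (by rw [norm_pow, hω.norm'_eq_one hD, one_pow])
  have hCS : ∀ d, ‖∑ c, P d c * Q d c‖ ^ 2 ≤ (∑ c, ‖P d c‖ ^ 2) * ∑ c, ‖Q d c‖ ^ 2 := fun d => by
    refine le_trans ?_ (Finset.sum_mul_sq_le_sq_mul_sq Finset.univ _ _)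
    gcongr
    exact (norm_sum_le _ _).trans_eq (Finset.sum_congr rfl fun c _ => norm_mul _ _)
  obtain ⟨x, hx⟩ := (fourierMatrix_bijective hD hω).2
    fun d => (∑ c, P d c * Q d c) / polyEval u (ω ^ (d : ℕ))
  have hxd : ∀ d, (fourierMatrix D ω).mulVec x d
      = (∑ c, P d c * Q d c) / polyEval u (ω ^ (d : ℕ)) := fun d => congrFun hx d
  have hmul : ∀ d : Fin D, polyEval u (ω ^ (d : ℕ)) * (fourierMatrix D ω).mulVec x d
      = ∑ c, P d c * Q d c := fun d => by
    rw [hxd]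
    refine mul_div_cancel_of_imp' fun h0 => ?_
    have h1 := hCS d
    rw [← hun, h0, norm_zero] at h1
    exact norm_eq_zero.1 (by nlinarith [norm_nonneg (∑ c, P d c * Q d c)])
  have hle : ∀ d, ‖(fourierMatrix D ω).mulVec x d‖ ^ 2 ≤ ∑ c, ‖Q d c‖ ^ 2 := fun d => by
    rw [hxd, norm_div, div_pow, hun]
    refine div_le_of_le_mul₀ (by positivity) (by positivity) ?_
    rw [mul_comm]
    exact hCS d
  have hxnorm : ∑ l, ‖x l‖ ^ 2 ≤ ∑ l, ∑ c, V l c ^ 2 := by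
    refine le_of_mul_le_mul_left ?_ hDpos
    rw [← fourierMatrix_parseval hω, Finset.sum_comm (f := fun l c => V l c ^ 2), Finset.mul_sum]
    refine (Finset.sum_le_sum fun d _ => hle d).trans_eq ?_
    rw [Finset.sum_comm]
    refine Finset.sum_congr rfl fun c _ => ?_
    rw [fourierMatrix_parseval hω]
    simp
  have hconv : (fun m => ∑ k, (u k : ℂ) * x (subIdx m k))
      = fun m => (Real.sqrt D : ℂ) * (w m : ℂ) := by
    refine (fourierMatrix_bijective hD hω).1 (funext fun d => ?_)
    have h1 := h d
    rw [dft_eq_mulVec] at h1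
    have h2 : (fun m => (Real.sqrt D : ℂ) * (w m : ℂ))
      = (Real.sqrt D : ℂ) • fun m => (w m : ℂ) := rfl
    simp only
    rw [fourierMatrix_mulVec_conv hω.pow_eq_one, hmul, h2, Matrix.mulVec_smul, Pi.smul_apply,
      smul_eq_mul]
    rw [← hs] at h1
    field_simp at h1
    rw [h1]
  refine ⟨u, fun l => (x l).re, fun d => ?_, ?_⟩
  · have h1 := congrArg Complex.re (congrFun hconv d)
    simp only [Complex.re_sum, Complex.re_ofReal_mul, Complex.ofReal_re] at h1
    rw [h1, ← mul_assoc, one_div_mul_cancel (Real.sqrt_ne_zero'.2 hDpos), one_mul]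
  · rw [hu2, Finset.sum_comm (f := fun k c => U k c ^ 2)]
    refine add_le_add_right ?_ _
    refine le_trans (Finset.sum_le_sum fun l _ => ?_) hxnorm
    rw [← sq_abs]
    gcongr
    exact Complex.abs_re_le_norm _

/-- Tightness of the SDP relaxation: `R_{K,C}(w) = R_SDP^K(w)`. -/
theorem induced_reg_eq_sdp (K D C : ℕ) (hK : 1 ≤ K) (hKD : K ≤ D) (hC : 1 ≤ C)
    (w : Fin D → ℝ) :
    inducedReg K D C w = sdpValue K D w := by
  have hD : D ≠ 0 := by omega
  set A := { t : ℝ | ∃ (U : Fin K → Fin C → ℝ) (V : Fin D → Fin C → ℝ),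
    predictor U V = w ∧ t = (∑ k, ∑ c, (U k c) ^ 2) + ∑ l, ∑ c, (V l c) ^ 2 }
  set B := { t : ℝ | ∃ Z : Matrix (Fin (K + D)) (Fin (K + D)) ℝ, Z.PosSemidef ∧
    (∀ d : Fin D, ∑ k : Fin K, ∑ l : Fin D,
      (1 / (D : ℂ)) *
        Complex.exp (-((2 : ℂ) * (Real.pi : ℂ) * Complex.I * ((d : ℕ) : ℂ) *
          (((k : ℕ) : ℂ) + ((l : ℕ) : ℂ))) / (D : ℂ)) *
        ((Z (Fin.castAdd D k) (Fin.natAdd K l) : ℝ) : ℂ) = dft w d) ∧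
    t = ∑ i, Z i i }
  have hAB : A ⊆ B := by
    rintro t ⟨U, V, rfl, rfl⟩
    obtain ⟨M, hMU, hMV⟩ : ∃ M : Matrix (Fin (K + D)) (Fin C) ℝ,
        (∀ k, M (Fin.castAdd D k) = U k) ∧ ∀ l, M (Fin.natAdd K l) = V l :=
      ⟨Fin.append U V, Fin.append_left U V, Fin.append_right U V⟩
    have hZ : ∀ i j, (M * M.conjTranspose) i j = ∑ c, M i c * M j c := fun i j => by
      simp [Matrix.mul_apply]
    refine ⟨M * M.conjTranspose, Matrix.posSemidef_self_mul_conjTranspose M, fun d => ?_, ?_⟩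
    · rw [dft_predictor hD, ← sdp_constraint_eq]
      simp only [hZ, hMU, hMV]
    · rw [Fin.sum_univ_add]
      simp only [hZ, hMU, hMV, sq]
  have hBA : ∀ t ∈ B, ∃ s ∈ A, s ≤ t := by
    rintro t ⟨Z, hZ, hc, rfl⟩
    obtain ⟨n, M, rfl⟩ := Matrix.posSemidef_iff_eq_sum_vecMulVec.1 hZ
    have hZ : ∀ i j, (∑ c, Matrix.vecMulVec (M c) (star (M c))) i j = ∑ c, M c i * M c j :=
      fun i j => by simp [Matrix.sum_apply, Matrix.vecMulVec_apply]
    simp only [hZ] at hc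
    obtain ⟨u, v, huv, hle⟩ := exists_single_channel hD (fun k c => M c (Fin.castAdd D k))
      (fun l c => M c (Fin.natAdd K l)) w fun d => by rw [← sdp_constraint_eq, hc d]
    have hsq : ∀ (r : ℝ) (c : Fin C), (if c = ⟨0, hC⟩ then r else 0) ^ 2
        = if c = ⟨0, hC⟩ then r ^ 2 else 0 := fun r c => by split_ifs <;> simp
    refine ⟨_, ⟨fun k c => if c = ⟨0, hC⟩ then u k else 0,
      fun l c => if c = ⟨0, hC⟩ then v l else 0, ?_, rfl⟩, ?_⟩
    · funext d
      rw [predictor_apply, Finset.sum_eq_single ⟨0, hC⟩]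
      · simpa using huv d
      · intro c _ hc0
        simp [hc0]
      · simp
    · rw [Fin.sum_univ_add]
      simp only [hsq, Finset.sum_ite_eq', Finset.mem_univ, if_true, hZ, ← sq]
      exact hle
  have hB0 : BddBelow B := ⟨0, by
    rintro t ht
    obtain ⟨s, ⟨U, V, -, rfl⟩, hs⟩ := hBA t ht
    exact le_trans (by positivity) hs⟩
  change sInf A = sInf B
  rcases B.eq_empty_or_nonempty with hBe | hBn
  · rw [hBe, Set.subset_eq_empty hAB hBe]
  · have hAn : A.Nonempty := by
      obtain ⟨t, ht⟩ := hBn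
      obtain ⟨s, hs, -⟩ := hBA t ht
      exact ⟨s, hs⟩
    refine le_antisymm (le_csInf hBn fun t ht => ?_) (csInf_le_csInf hB0 hAn hAB)
    obtain ⟨s, hs, hst⟩ := hBA t ht
    exact (csInf_le (hB0.mono hAB) hs).trans hst
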